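/- Let Γ be a distance-regular graph with diameter D ≥ 3 and fix a base vertex x. For 1 ≤ h,ℓ ≤ 3 and 1 ≤ i,j ≤ D, ⟨A_hE_i* − E_i*A_h, A_ℓE_j* − E_j*A_ℓ⟩ = 2 δ_{hℓ} k_h (δ_{ij} k_i − p^h_{ij}). -/

import Mathlib

open Matrix BigOperators

noncomputable section

structure DRG (X : Type) [Fintype X] [DecidableEq X] where
  G : SimpleGraph X
  D : ℕ
  hD : 3 ≤ D
  hconn : G.Connected
  hdiam_le : ∀ y z : X, G.dist y z ≤ D
  hdiam : ∃ y z : X, G.dist y z = D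
  p : ℕ → ℕ → ℕ → ℕ
  hp : ∀ h i j : ℕ, h ≤ D → i ≤ D → j ≤ D → ∀ y z : X, G.dist y z = h →
    Nat.card {w : X // G.dist y w = i ∧ G.dist z w = j} = p h i j

namespace DRG

variable {X : Type} [Fintype X] [DecidableEq X]

/-- The `i`-th distance matrix. -/
def A (Γ : DRG X) (i : ℕ) : Matrix X X ℂ :=
  Matrix.of fun y z => if Γ.G.dist y z = i then (1 : ℂ) else 0

/-- `c_i`, with the conventions `c_0 = 0` and `c_{D+1} = 1`. -/
def cI (Γ : DRG X) (i : ℕ) : ℕ :=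
  if i = 0 then 0 else if i ≤ Γ.D then Γ.p i 1 (i - 1) else 1

/-- `a_i`. -/
def aI (Γ : DRG X) (i : ℕ) : ℕ := Γ.p i 1 i

/-- `b_i`, with the convention `b_D = 0`. -/
def bI (Γ : DRG X) (i : ℕ) : ℕ := if i < Γ.D then Γ.p i 1 (i + 1) else 0

/-- `k_i`. -/
def kI (Γ : DRG X) (i : ℕ) : ℕ := Γ.p 0 i i

/-- The valency `k = b_0`. -/
def kval (Γ : DRG X) : ℕ := Γ.p 0 1 1

/-- `Γ` is primitive: each distance-`i` graph is connected. -/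
def Primitive (Γ : DRG X) : Prop :=
  ∀ i : ℕ, 1 ≤ i → i ≤ Γ.D →
    (SimpleGraph.fromRel fun y z => Γ.G.dist y z = i).Connected

/-- The Hermitean inner product `⟨R,S⟩ = tr(Rᵗ S̄)`. -/
def inn (R S : Matrix X X ℂ) : ℂ := (Rᵀ * S.map (starRingEnd ℂ)).trace

/-- The dual idempotent `E_i*` with respect to the base vertex `x`. -/
def Estar (Γ : DRG X) (x : X) (i : ℕ) : Matrix X X ℂ :=
  Matrix.diagonal fun y => if Γ.G.dist x y = i then (1 : ℂ) else 0

/-- The polynomials `v_i`. -/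
def vpoly (Γ : DRG X) : ℕ → Polynomial ℝ
  | 0 => 1
  | 1 => Polynomial.X
  | n + 2 =>
      ((Γ.cI (n + 2) : ℝ))⁻¹ •
        (Polynomial.X * vpoly Γ (n + 1) - (Γ.aI (n + 1) : ℝ) • vpoly Γ (n + 1)
          - (Γ.bI n : ℝ) • vpoly Γ n)

/-- The polynomials `u_i = v_i / k_i`. -/
def upoly (Γ : DRG X) (i : ℕ) : Polynomial ℝ := ((Γ.kI i : ℝ))⁻¹ • Γ.vpoly i

end DRG

/-- A system of primitive idempotents (with eigenvalues and Krein parameters) for `Γ`. -/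
structure IdemSys {X : Type} [Fintype X] [DecidableEq X] (Γ : DRG X) where
  E : Fin (Γ.D + 1) → Matrix X X ℂ
  θ : Fin (Γ.D + 1) → ℝ
  q : Fin (Γ.D + 1) → Fin (Γ.D + 1) → Fin (Γ.D + 1) → ℝ
  hE0 : E 0 = ((Fintype.card X : ℂ))⁻¹ • Matrix.of fun _ _ => (1 : ℂ)
  hEsum : ∑ i, E i = 1
  hEmul : ∀ i j, E i * E j = if i = j then E i else 0
  hEsymm : ∀ i, (E i)ᵀ = E i
  hEreal : ∀ i, (E i).map (starRingEnd ℂ) = E i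
  hEbasis : ∀ i, E i ∈ Submodule.span ℂ (Set.range fun n : Fin (Γ.D + 1) => Γ.A (n : ℕ))
  hEig : ∀ j, Γ.A 1 * E j = (θ j : ℂ) • E j
  hθ0 : θ 0 = (Γ.kval : ℝ)
  hθinj : Function.Injective θ
  hKrein : ∀ i j, Matrix.hadamard (E i) (E j) =
    ((Fintype.card X : ℂ))⁻¹ • ∑ h, (q h i j : ℂ) • E h

namespace IdemSys

variable {X : Type} [Fintype X] [DecidableEq X] {Γ : DRG X}

/-- `m_j`, the rank of `E_j`. -/
def m (I : IdemSys Γ) (j : Fin (Γ.D + 1)) : ℕ := (I.E j).rank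

/-- The dual distance matrix `A_i*` with respect to `x` and `E_i`. -/
def Astar (I : IdemSys Γ) (x : X) (i : Fin (Γ.D + 1)) : Matrix X X ℂ :=
  Matrix.diagonal fun y => (Fintype.card X : ℂ) * I.E i x y

end IdemSys

/-- `Γ` is Q-polynomial with respect to the ordering `E_{σ 0}, ..., E_{σ D}`. -/
def QPolyOrdering {X : Type} [Fintype X] [DecidableEq X] {Γ : DRG X} (I : IdemSys Γ)
    (σ : Equiv.Perm (Fin (Γ.D + 1))) : Prop :=
  ∀ h i j : Fin (Γ.D + 1),
    (((i : ℕ) + (j : ℕ) < (h : ℕ) ∨ (h : ℕ) + (j : ℕ) < (i : ℕ) ∨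
        (h : ℕ) + (i : ℕ) < (j : ℕ)) → I.q (σ h) (σ i) (σ j) = 0) ∧
    (((h : ℕ) = (i : ℕ) + (j : ℕ) ∨ (i : ℕ) = (h : ℕ) + (j : ℕ) ∨
        (j : ℕ) = (h : ℕ) + (i : ℕ)) → I.q (σ h) (σ i) (σ j) ≠ 0)

/-- The matrix `S^alt`. -/
def salt {n : ℕ} (S : Matrix (Fin (n + 1)) (Fin (n + 1)) ℂ) : Matrix (Fin n) (Fin n) ℂ :=
  Matrix.of fun i j => S i.succ j.succ - S 0 j.succ

/-- The matrix `(S^{-1})^alt`. -/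
def altInv {n : ℕ} (T : Matrix (Fin (n + 1)) (Fin (n + 1)) ℂ) : Matrix (Fin n) (Fin n) ℂ :=
  Matrix.of fun i j => T i.succ j.succ

/-- The `4D` matrices `A_2E_i*A − AE_i*A_2, A_3E_i* − E_i*A_3, A_2E_i* − E_i*A_2, AE_i* − E_i*A`. -/
def vecE {X : Type} [Fintype X] [DecidableEq X] (Γ : DRG X) (x : X)
    (a : Fin 4) (i : Fin Γ.D) : Matrix X X ℂ :=
  ![Γ.A 2 * Γ.Estar x ((i : ℕ) + 1) * Γ.A 1 - Γ.A 1 * Γ.Estar x ((i : ℕ) + 1) * Γ.A 2,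
    Γ.A 3 * Γ.Estar x ((i : ℕ) + 1) - Γ.Estar x ((i : ℕ) + 1) * Γ.A 3,
    Γ.A 2 * Γ.Estar x ((i : ℕ) + 1) - Γ.Estar x ((i : ℕ) + 1) * Γ.A 2,
    Γ.A 1 * Γ.Estar x ((i : ℕ) + 1) - Γ.Estar x ((i : ℕ) + 1) * Γ.A 1] a

/-- The `4D` matrices `A_2A_i*A − AA_i*A_2, A_3A_i* − A_i*A_3, A_2A_i* − A_i*A_2, AA_i* − A_i*A`. -/
def vecA {X : Type} [Fintype X] [DecidableEq X] {Γ : DRG X} (I : IdemSys Γ) (x : X)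
    (a : Fin 4) (i : Fin Γ.D) : Matrix X X ℂ :=
  ![Γ.A 2 * I.Astar x i.succ * Γ.A 1 - Γ.A 1 * I.Astar x i.succ * Γ.A 2,
    Γ.A 3 * I.Astar x i.succ - I.Astar x i.succ * Γ.A 3,
    Γ.A 2 * I.Astar x i.succ - I.Astar x i.succ * Γ.A 2,
    Γ.A 1 * I.Astar x i.succ - I.Astar x i.succ * Γ.A 1] a

namespace DRG

variable {X : Type} [Fintype X] [DecidableEq X]

lemma A_apply (Γ : DRG X) (i : ℕ) (y z : X) :
    Γ.A i y z = if Γ.G.dist y z = i then (1 : ℂ) else 0 := rfl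

lemma A_comm (Γ : DRG X) (i : ℕ) (y z : X) : Γ.A i y z = Γ.A i z y := by
  simp only [A_apply, SimpleGraph.dist_comm]

lemma A_mul_A (Γ : DRG X) (i j : ℕ) (y z : X) :
    Γ.A i y z * Γ.A j y z = (if i = j then 1 else 0) * Γ.A i y z := by
  simp only [A_apply]
  split_ifs <;> simp_all

lemma star_A (Γ : DRG X) (i : ℕ) (y z : X) : starRingEnd ℂ (Γ.A i y z) = Γ.A i y z := by
  rw [A_apply]
  split_ifs <;> simp

lemma Estar_eq (Γ : DRG X) (x : X) (i : ℕ) : Γ.Estar x i = Matrix.diagonal (Γ.A i x) := rfl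

lemma sum_A_mul_A (Γ : DRG X) {h i j : ℕ} (hh : h ≤ Γ.D) (hi : i ≤ Γ.D) (hj : j ≤ Γ.D)
    {y z : X} (hyz : Γ.G.dist y z = h) :
    ∑ w, Γ.A i y w * Γ.A j z w = (Γ.p h i j : ℂ) := by
  rw [← Γ.hp h i j hh hi hj y z hyz, Nat.card_eq_fintype_card, Fintype.card_subtype]
  simp only [A_apply, ← ite_and, mul_ite, mul_one, mul_zero, Finset.sum_boole, and_comm]

lemma A_mul_sum_A_mul_A (Γ : DRG X) {h i j : ℕ} (hh : h ≤ Γ.D) (hi : i ≤ Γ.D) (hj : j ≤ Γ.D)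
    (y z : X) :
    Γ.A h y z * ∑ w, Γ.A i y w * Γ.A j z w = Γ.A h y z * (Γ.p h i j : ℂ) := by
  by_cases hyz : Γ.G.dist y z = h
  · rw [Γ.sum_A_mul_A hh hi hj hyz]
  · simp [A_apply, hyz]

lemma sum_A (Γ : DRG X) {i : ℕ} (hi : i ≤ Γ.D) (y : X) : ∑ z, Γ.A i y z = (Γ.kI i : ℂ) := by
  rw [kI, ← Γ.sum_A_mul_A (Nat.zero_le _) hi hi (SimpleGraph.dist_self (v := y))]
  simp [A_mul_A]

/-- The number of pairs `y`, `z` with `∂(x,y) = i`, `∂(x,z) = j` and `∂(y,z) = h`, counted by first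
choosing `y`. -/
lemma sum_triple (Γ : DRG X) {h i j : ℕ} (hh : h ≤ Γ.D) (hi : i ≤ Γ.D) (hj : j ≤ Γ.D) (x : X) :
    ∑ y, ∑ z, Γ.A h y z * (Γ.A i x y * Γ.A j x z) = (Γ.kI i : ℂ) * (Γ.p i j h : ℂ) := by
  rw [← Γ.sum_A hi x, Finset.sum_mul]
  refine Finset.sum_congr rfl fun y _ => ?_
  rw [← Γ.A_mul_sum_A_mul_A hi hj hh, Finset.mul_sum]
  exact Finset.sum_congr rfl fun z _ => by ring

lemma kI_mul_p (Γ : DRG X) {h i j : ℕ} (hh : h ≤ Γ.D) (hi : i ≤ Γ.D) (hj : j ≤ Γ.D) :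
    (Γ.kI i : ℂ) * (Γ.p i j h : ℂ) = (Γ.kI h : ℂ) * (Γ.p h i j : ℂ) := by
  have : Nonempty X := Γ.hconn.nonempty
  have hX : (Fintype.card X : ℂ) ≠ 0 := Nat.cast_ne_zero.mpr Fintype.card_ne_zero
  refine mul_left_cancel₀ hX ?_
  calc (Fintype.card X : ℂ) * ((Γ.kI i : ℂ) * (Γ.p i j h : ℂ))
      = ∑ x, ∑ y, ∑ z, Γ.A h y z * (Γ.A i x y * Γ.A j x z) := by
        simp [Γ.sum_triple hh hi hj]
    _ = ∑ y, ∑ z, ∑ x, Γ.A h y z * (Γ.A i y x * Γ.A j z x) := by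
        rw [Finset.sum_comm]
        refine Finset.sum_congr rfl fun y _ => ?_
        rw [Finset.sum_comm]
        refine Finset.sum_congr rfl fun z _ => Finset.sum_congr rfl fun x _ => ?_
        rw [Γ.A_comm i, Γ.A_comm j]
    _ = (Fintype.card X : ℂ) * ((Γ.kI h : ℂ) * (Γ.p h i j : ℂ)) := by
        simp [← Finset.mul_sum, Γ.A_mul_sum_A_mul_A hh hi hj, ← Finset.sum_mul, Γ.sum_A hh]

lemma inn_eq_sum {X : Type} [Fintype X] (R S : Matrix X X ℂ) :
    inn R S = ∑ y, ∑ z, R y z * starRingEnd ℂ (S y z) := by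
  simp only [inn, Matrix.trace, Matrix.diag, Matrix.mul_apply, Matrix.transpose_apply,
    Matrix.map_apply]
  exact Finset.sum_comm

lemma commutator_apply (Γ : DRG X) (x : X) (h i : ℕ) (y z : X) :
    (Γ.A h * Γ.Estar x i - Γ.Estar x i * Γ.A h) y z =
      Γ.A h y z * (Γ.A i x z - Γ.A i x y) := by
  rw [Estar_eq, Matrix.sub_apply, Matrix.mul_diagonal, Matrix.diagonal_mul]
  ring

lemma sum_A_mul_left (Γ : DRG X) {h i : ℕ} (hh : h ≤ Γ.D) (hi : i ≤ Γ.D) (x : X) :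
    ∑ y, ∑ z, Γ.A h y z * Γ.A i x y = (Γ.kI h : ℂ) * (Γ.kI i : ℂ) := by
  simp [← Finset.sum_mul, ← Finset.mul_sum, Γ.sum_A hh, Γ.sum_A hi]

lemma sum_A_mul_right (Γ : DRG X) {h i : ℕ} (hh : h ≤ Γ.D) (hi : i ≤ Γ.D) (x : X) :
    ∑ y, ∑ z, Γ.A h y z * Γ.A i x z = (Γ.kI h : ℂ) * (Γ.kI i : ℂ) := by
  rw [Finset.sum_comm, ← Γ.sum_A_mul_left hh hi x]
  simp only [Γ.A_comm h]

end DRG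

/-- `⟨A_hE_i* − E_i*A_h, A_ℓE_j* − E_j*A_ℓ⟩ = 2δ_{hℓ} k_h (δ_{ij}k_i − p^h_{ij})`
for `1 ≤ h, ℓ ≤ 3` and `1 ≤ i, j ≤ D`. -/
theorem stmt_11 {X : Type} [Fintype X] [DecidableEq X] (Γ : DRG X) (x : X) :
    ∀ h l : ℕ, 1 ≤ h → h ≤ 3 → 1 ≤ l → l ≤ 3 →
      ∀ i j : ℕ, 1 ≤ i → i ≤ Γ.D → 1 ≤ j → j ≤ Γ.D →
        DRG.inn (Γ.A h * Γ.Estar x i - Γ.Estar x i * Γ.A h)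
            (Γ.A l * Γ.Estar x j - Γ.Estar x j * Γ.A l) =
          2 * (if h = l then 1 else 0) * (Γ.kI h : ℂ) *
            ((if i = j then 1 else 0) * (Γ.kI i : ℂ) - (Γ.p h i j : ℂ)) := by
  intro h l _ hh3 _ _ i j _ hi _ hj
  have hh : h ≤ Γ.D := hh3.trans Γ.hD
  have hterm : ∀ y z : X,
      (Γ.A h * Γ.Estar x i - Γ.Estar x i * Γ.A h) y z *
        starRingEnd ℂ ((Γ.A l * Γ.Estar x j - Γ.Estar x j * Γ.A l) y z) =
      (if h = l then 1 else 0) *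
        ((if i = j then 1 else 0) * (Γ.A h y z * Γ.A i x y)
          + (if i = j then 1 else 0) * (Γ.A h y z * Γ.A i x z)
          - Γ.A h y z * (Γ.A i x y * Γ.A j x z) - Γ.A h z y * (Γ.A i x z * Γ.A j x y)) := by
    intro y z
    rw [Γ.commutator_apply, Γ.commutator_apply, map_mul, map_sub, Γ.star_A, Γ.star_A, Γ.star_A,
      Γ.A_comm h z y]
    linear_combination (Γ.A i x z - Γ.A i x y) * (Γ.A j x z - Γ.A j x y) * Γ.A_mul_A h l y z
      + (if h = l then 1 else 0) * Γ.A h y z * (Γ.A_mul_A i j x y + Γ.A_mul_A i j x z)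
  have hswap : ∑ y, ∑ z, Γ.A h z y * (Γ.A i x z * Γ.A j x y) = Γ.kI h * Γ.p h i j := by
    rw [Finset.sum_comm, Γ.sum_triple hh hi hj, Γ.kI_mul_p hh hi hj]
  simp only [DRG.inn_eq_sum, hterm, ← Finset.mul_sum, Finset.sum_sub_distrib,
    Finset.sum_add_distrib, Γ.sum_A_mul_left hh hi, Γ.sum_A_mul_right hh hi,
    Γ.sum_triple hh hi hj, Γ.kI_mul_p hh hi hj, hswap]
  ring
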